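/- Let h₁, h₂ define bisectors and let p ∈ V satisfy ⟨p,p⟩ < 0, ⟨h₁p,p⟩ = 0, ⟨h₂p,p⟩ = 0, h₁p ≠ 0, and h₂p ≠ 0. If h₁p and h₂p are ℝ-linearly dependent in V (i.e., the bisectors are not transversal at [p]), then det h = 0 for every h in the ℝ-linear span of h₁ and h₂, and there exists a complex projective line L with [p] ∈ L and L ⊆ B_{h₁} ∩ B_{h₂} (the bisectors have a common slice through [p]). -/

import Mathlib

open scoped ComplexConjugate

noncomputable section

/-- `V` is `ℂ³`. -/
abbrev V3 : Type := Fin 3 → ℂ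

/-- The hermitian form of signature `(2,1)`:
`⟨x,y⟩ = x₀·conj y₀ + x₁·conj y₁ − x₂·conj y₂`. -/
def herm (x y : V3) : ℂ := x 0 * conj (y 0) + x 1 * conj (y 1) - x 2 * conj (y 2)

/-- The complex projective plane `ℙ(V)`. -/
abbrev PV : Type := Projectivization ℂ V3

/-- The class `[v]` of a nonzero vector `v` in `ℙ(V)`. -/
def projMk (v : V3) (hv : v ≠ 0) : PV := Projectivization.mk ℂ v hv

/-- A map `h` is self-adjoint (`h* = h`) w.r.t. the hermitian form. -/
def SelfAdj (h : Module.End ℂ V3) : Prop := ∀ x y : V3, herm (h x) y = herm x (h y)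

/-- The set `B_h = {[v] ∈ ℙ(V) | ⟨h v, v⟩ = 0}`. -/
def Bset (h : Module.End ℂ V3) : Set PV :=
  {q | ∃ v : V3, ∃ hv : v ≠ 0, q = projMk v hv ∧ herm (h v) v = 0}

/-- `h` defines a bisector: self-adjoint, trace `0`, rank `2`, and `B_h` contains
a point other than the focus (i.e. a point `[v]` with `h v ≠ 0`). -/
def IsBisector (h : Module.End ℂ V3) : Prop :=
  SelfAdj h ∧ LinearMap.trace ℂ V3 h = 0 ∧
    Module.finrank ℂ (LinearMap.range h) = 2 ∧ ∃ v : V3, herm (h v) v = 0 ∧ h v ≠ 0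

/-- A linear family of bisectors: an `ℝ`-subspace of self-adjoint traceless
degenerate maps whose base contains a negative point. -/
def IsLinearFamily (W : Submodule ℝ (Module.End ℂ V3)) : Prop :=
  (∀ h ∈ W, SelfAdj h ∧ LinearMap.trace ℂ V3 h = 0 ∧ LinearMap.det h = 0) ∧
    ∃ v : V3, ∃ hv : v ≠ 0, (herm v v).re < 0 ∧ ∀ h ∈ W, herm (h v) v = 0

/-- The map `x ↦ ⟨x,p⟩·p`. -/
def wmap (p : V3) : Module.End ℂ V3 where
  toFun x := herm x p • p
  map_add' x y := by
    show herm (x + y) p • p = herm x p • p + herm y p • p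
    have : herm (x + y) p = herm x p + herm y p := by
      simp only [herm, Pi.add_apply]; ring
    rw [this, add_smul]
  map_smul' c x := by
    show herm (c • x) p • p = c • (herm x p • p)
    have : herm (c • x) p = c * herm x p := by
      simp only [herm, Pi.smul_apply, smul_eq_mul]; ring
    rw [this, mul_smul]

/-- `ℙ(U)` for a complex subspace `U`. -/
def projC (U : Submodule ℂ V3) : Set PV :=
  {q | ∃ v : V3, ∃ hv : v ≠ 0, v ∈ U ∧ q = projMk v hv}

/-- `ℙ(T)` for a real subspace `T`. -/
def projR (T : Submodule ℝ V3) : Set PV :=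
  {q | ∃ v : V3, ∃ hv : v ≠ 0, v ∈ T ∧ q = projMk v hv}

/-- An `ℝ`-plane: `ℙ(T)` for a totally real `3`-dimensional real subspace `T`
with `ℂ·T = V`. -/
def IsRealPlane (T : Submodule ℝ V3) : Prop :=
  Module.finrank ℝ T = 3 ∧ Submodule.span ℂ (T : Set V3) = ⊤ ∧
    ∀ t ∈ T, ∀ t' ∈ T, (herm t t').im = 0

/-- A geodesic: `ℙ(W₀)` for a `2`-dimensional real subspace `W₀` on which the form
is real-valued and not identically zero. -/
def IsGeodesic (W₀ : Submodule ℝ V3) : Prop :=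
  Module.finrank ℝ W₀ = 2 ∧ (∀ w ∈ W₀, ∀ w' ∈ W₀, (herm w w').im = 0) ∧
    ∃ w ∈ W₀, ∃ w' ∈ W₀, herm w w' ≠ 0

/-- The real spine `R = {[h v] | [v] ∈ B_h, h v ≠ 0}` of `B_h`. -/
def RealSpine (h : Module.End ℂ V3) : Set PV :=
  {q | ∃ v : V3, ∃ hnz : h v ≠ 0, herm (h v) v = 0 ∧ q = projMk (h v) hnz}

/-- The orthogonal complement w.r.t. the hermitian form. -/
def hermOrth (U : Submodule ℂ V3) : Submodule ℂ V3 where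
  carrier := {x | ∀ u ∈ U, herm x u = 0}
  add_mem' := by
    intro a b ha hb u hu
    have h1 : herm (a + b) u = herm a u + herm b u := by
      simp only [herm, Pi.add_apply]; ring
    rw [h1, ha u hu, hb u hu, add_zero]
  zero_mem' := by
    intro u hu
    simp [herm]
  smul_mem' := by
    intro c x hx u hu
    have h1 : herm (c • x) u = c * herm x u := by
      simp only [herm, Pi.smul_apply, smul_eq_mul]; ring
    rw [h1, hx u hu, mul_zero]


/-- The linear functional `v ↦ ⟨v,q⟩`. -/
def hermRight (q : V3) : V3 →ₗ[ℂ] ℂ where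
  toFun v := herm v q
  map_add' x y := by simp only [herm, Pi.add_apply]; ring
  map_smul' c x := by
    simp only [herm, Pi.smul_apply, smul_eq_mul, RingHom.id_apply]; ring

lemma mem_ker_hermRight {q v : V3} : v ∈ LinearMap.ker (hermRight q) ↔ herm v q = 0 :=
  Iff.rfl

lemma herm_smul_left (c : ℂ) (x y : V3) : herm (c • x) y = c * herm x y :=
  (hermRight y).map_smul c x

lemma conj_herm (x y : V3) : conj (herm x y) = herm y x := by
  simp only [herm, map_sub, map_add, map_mul, Complex.conj_conj]; ring

lemma herm_smul_right (c : ℂ) (x y : V3) : herm x (c • y) = conj c * herm x y := by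
  rw [← conj_herm, herm_smul_left, map_mul, conj_herm]

lemma herm_eq_zero_comm {x y : V3} : herm x y = 0 ↔ herm y x = 0 := by
  rw [← conj_herm, map_eq_zero]

lemma hermRight_ne_zero {q : V3} (hq : q ≠ 0) : hermRight q ≠ 0 := by
  contrapose! hq
  have key (v : V3) : herm v q = 0 := LinearMap.congr_fun hq v
  ext i
  have := key (Pi.single i 1)
  fin_cases i <;> simpa [herm] using this

lemma finrank_ker_hermRight {q : V3} (hq : q ≠ 0) :
    Module.finrank ℂ (LinearMap.ker (hermRight q)) = 2 := by
  have h := (hermRight q).finrank_range_add_finrank_ker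
  rw [LinearMap.range_eq_top.2 (LinearMap.surjective (hermRight_ne_zero hq)), finrank_top,
    Module.finrank_self, Module.finrank_fin_fun] at h
  omega

lemma IsBisector.exists_ker {h : Module.End ℂ V3} (hb : IsBisector h) :
    ∃ k : V3, k ≠ 0 ∧ h k = 0 := by
  have hrank := h.finrank_range_add_finrank_ker
  rw [hb.2.2.1, Module.finrank_fin_fun] at hrank
  have : LinearMap.ker h ≠ ⊥ := by
    intro hbot
    rw [hbot, finrank_bot] at hrank
    omega
  obtain ⟨k, hk, hk0⟩ := (Submodule.ne_bot_iff _).1 this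
  exact ⟨k, hk0, hk⟩

/-- If `p` is orthogonal to its image under a degenerate self-adjoint map `h` and `h p` spans
the line of `q`, then `h` maps the orthogonal of `q` into the line of `q`. -/
lemma map_ker_hermRight_le {h : Module.End ℂ V3} (hsa : SelfAdj h) {k : V3} (hk0 : k ≠ 0)
    (hk : h k = 0) {p q : V3} {c : ℂ} (hc : c ≠ 0) (hq : q ≠ 0) (hpq : h p = c • q)
    (hort : herm p q = 0) :
    (LinearMap.ker (hermRight q)).map h ≤ ℂ ∙ q := by
  have hkq : herm k q = 0 := by
    have h1 := hsa k p
    rw [hk, hpq, herm_smul_right] at h1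
    have h0 : herm 0 p = 0 := (hermRight p).map_zero
    rw [h0] at h1
    simpa [hc] using h1.symm
  have hli : LinearIndependent ℂ ![p, k] := by
    rw [LinearIndependent.pair_iff]
    intro s t hst
    have h1 := congrArg h hst
    rw [map_add, map_smul, map_smul, hk, hpq, smul_zero, add_zero, map_zero] at h1
    have hs : s = 0 := by simpa [hc, hq] using h1
    subst hs
    exact ⟨rfl, by simpa [hk0] using hst⟩
  have hspan : Submodule.span ℂ (Set.range ![p, k]) = LinearMap.ker (hermRight q) := by
    apply Submodule.eq_of_le_of_finrank_eq
    · rw [Submodule.span_le]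
      rintro _ ⟨i, rfl⟩
      fin_cases i
      · exact hort
      · exact hkq
    · rw [finrank_span_eq_card hli, finrank_ker_hermRight hq, Fintype.card_fin]
  rw [← hspan, Submodule.map_span_le]
  rintro _ ⟨i, rfl⟩
  fin_cases i
  · simpa [hpq] using Submodule.smul_mem _ c (Submodule.mem_span_singleton_self q)
  · simp [hk]

lemma projC_ker_hermRight_subset_Bset {h : Module.End ℂ V3} {q : V3}
    (hle : (LinearMap.ker (hermRight q)).map h ≤ ℂ ∙ q) :
    projC (LinearMap.ker (hermRight q)) ⊆ Bset h := by
  rintro _ ⟨v, hv, hvU, rfl⟩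
  refine ⟨v, hv, rfl, ?_⟩
  obtain ⟨a, ha⟩ := Submodule.mem_span_singleton.1 (hle (Submodule.mem_map_of_mem hvU))
  rw [← ha, herm_smul_left, herm_eq_zero_comm.1 (mem_ker_hermRight.1 hvU), mul_zero]

lemma det_eq_zero_of_map_ker_hermRight_le {f : Module.End ℂ V3} {q : V3} (hq : q ≠ 0)
    (hle : (LinearMap.ker (hermRight q)).map f ≤ ℂ ∙ q) : LinearMap.det f = 0 := by
  by_contra hdet
  have h1 := Submodule.finrank_mono hle
  have h2 : Module.finrank ℂ ((LinearMap.ker (hermRight q)).map f) =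
      Module.finrank ℂ (LinearMap.ker (hermRight q)) :=
    LinearEquiv.finrank_map_eq (LinearMap.equivOfDetNeZero f hdet) _
  rw [finrank_span_singleton hq, h2, finrank_ker_hermRight hq] at h1
  omega

/-- Lemma 4.6: if two bisectors are not transversal at a common negative
point `[p]` (other than the foci), then every real combination of `h₁, h₂` is degenerate
and the bisectors have a common slice through `[p]`. -/
theorem stmt_6 (h₁ h₂ : Module.End ℂ V3)
    (hb₁ : IsBisector h₁) (hb₂ : IsBisector h₂)
    (p : V3) (hp0 : p ≠ 0) (hneg : (herm p p).re < 0)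
    (hp1 : herm (h₁ p) p = 0) (hp2 : herm (h₂ p) p = 0)
    (hn1 : h₁ p ≠ 0) (hn2 : h₂ p ≠ 0)
    (hdep : ¬ LinearIndependent ℝ ![h₁ p, h₂ p]) :
    (∀ a b : ℝ, LinearMap.det (a • h₁ + b • h₂) = 0) ∧
      ∃ U : Submodule ℂ V3, Module.finrank ℂ U = 2 ∧ p ∈ U ∧
        projC U ⊆ Bset h₁ ∩ Bset h₂ := by
  obtain ⟨c, hc⟩ : ∃ c : ℝ, c • h₁ p = h₂ p := by
    rw [LinearIndependent.pair_iff' hn1] at hdep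
    push Not at hdep
    exact hdep
  have hc0 : (c : ℂ) ≠ 0 := by
    rintro h0
    rw [Complex.ofReal_eq_zero.1 h0, zero_smul] at hc
    exact hn2 hc.symm
  have hort : herm p (h₁ p) = 0 := herm_eq_zero_comm.1 hp1
  obtain ⟨k₁, hk₁0, hk₁⟩ := hb₁.exists_ker
  obtain ⟨k₂, hk₂0, hk₂⟩ := hb₂.exists_ker
  have hle₁ := map_ker_hermRight_le hb₁.1 hk₁0 hk₁ one_ne_zero hn1 (one_smul ℂ _).symm hort
  have hle₂ := map_ker_hermRight_le hb₂.1 hk₂0 hk₂ hc0 hn1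
    (hc.symm.trans (Complex.coe_smul c _).symm) hort
  refine ⟨fun a b ↦ det_eq_zero_of_map_ker_hermRight_le hn1 ?_, LinearMap.ker (hermRight (h₁ p)),
    finrank_ker_hermRight hn1, hort, Set.subset_inter (projC_ker_hermRight_subset_Bset hle₁)
      (projC_ker_hermRight_subset_Bset hle₂)⟩
  rintro _ ⟨v, hv, rfl⟩
  rw [LinearMap.add_apply, LinearMap.smul_apply, LinearMap.smul_apply,
    ← Complex.coe_smul a, ← Complex.coe_smul b]
  exact Submodule.add_mem _ (Submodule.smul_mem _ _ (hle₁ (Submodule.mem_map_of_mem hv)))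
    (Submodule.smul_mem _ _ (hle₂ (Submodule.mem_map_of_mem hv)))

end
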